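/- arXiv:1404.7053 — 3 statements merged into one kernel-verified Lean document; each statement's English description precedes it below -/
import Mathlib

section
/- For every natural number q ≥ 1 and every x ∈ [0,1], it holds that |α_q(x) − x| ≤ 1/q. -/
open scoped BigOperators

/-- The piecewise linear "step" function `β_{p,q}` on `[0,1]`. -/
noncomputable def beta (p q : ℕ) (x : ℝ) : ℝ :=
  if x ≤ (p : ℝ) / q then 0
  else if x ≤ ((p : ℝ) + (2:ℝ) ^ (-(q:ℤ))) / q then (2:ℝ) ^ q * (x - (p : ℝ) / q)
  else 1 / q

/-- `α_q(x) = ∑_{p=0}^{q-1} β_{p,q}(x)`. -/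
noncomputable def alpha (q : ℕ) (x : ℝ) : ℝ := ∑ p ∈ Finset.range q, beta p q x

/-- `F(x) = ∑_{q=1}^∞ (1/q²)·α_q(x)`. -/
noncomputable def F (x : ℝ) : ℝ := ∑' q : ℕ, (1 / ((q:ℝ) + 1) ^ 2) * alpha (q + 1) x

theorem beta_of_le {p q : ℕ} {x : ℝ} (h : x ≤ (p : ℝ) / q) : beta p q x = 0 :=
  if_pos h

theorem beta_le_one_div (p q : ℕ) (x : ℝ) : beta p q x ≤ 1 / q := by
  unfold beta
  split_ifs with h₁ h₂
  · positivity
  · have h : x - (p : ℝ) / q ≤ (2 : ℝ) ^ (-(q : ℤ)) / q := by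
      rw [add_div] at h₂
      linarith
    calc (2 : ℝ) ^ q * (x - (p : ℝ) / q)
        ≤ 2 ^ q * ((2 : ℝ) ^ (-(q : ℤ)) / q) := by gcongr
      _ = 1 / q := by
        rw [zpow_neg, zpow_natCast, ← mul_div_assoc, mul_inv_cancel₀ (by positivity)]
  · exact le_rfl

/-- `β_{p,q}` dominates the amount of `[0, x]` lying in `[p/q, (p+1)/q]`. -/
theorem min_sub_min_le_beta (p q : ℕ) (x : ℝ) :
    min x (((p + 1 : ℕ) : ℝ) / q) - min x ((p : ℝ) / q) ≤ beta p q x := by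
  by_cases h₁ : x ≤ (p : ℝ) / q
  · rw [beta_of_le h₁, min_eq_left h₁]
    linarith [min_le_left x (((p + 1 : ℕ) : ℝ) / q)]
  · rw [min_eq_right (not_le.mp h₁).le, beta, if_neg h₁]
    split_ifs with h₂
    · have h := le_mul_of_one_le_left (sub_nonneg.mpr (not_le.mp h₁).le)
        (one_le_pow₀ (one_le_two : (1 : ℝ) ≤ 2) (n := q))
      linarith [min_le_left x (((p + 1 : ℕ) : ℝ) / q)]
    · have h := min_le_right x (((p + 1 : ℕ) : ℝ) / q)
      push_cast [add_div] at h ⊢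
      linarith

/-- `β_{p+1,q}` is dominated by the amount of `[0, x]` lying in `[p/q, (p+1)/q]`. -/
theorem beta_succ_le_min_sub_min (p q : ℕ) (x : ℝ) :
    beta (p + 1) q x ≤ min x (((p + 1 : ℕ) : ℝ) / q) - min x ((p : ℝ) / q) := by
  by_cases h : x ≤ ((p + 1 : ℕ) : ℝ) / q
  · rw [beta_of_le h, min_eq_left h]
    linarith [min_le_left x ((p : ℝ) / q)]
  · rw [min_eq_right (not_le.mp h).le]
    have h₁ := beta_le_one_div (p + 1) q x
    have h₂ := min_le_right x ((p : ℝ) / q)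
    push_cast [add_div]
    linarith

theorem alpha_close_to_id (q : ℕ) (hq : 1 ≤ q) :
    ∀ x ∈ Set.Icc (0:ℝ) 1, |alpha q x - x| ≤ 1 / q := by
  rintro x ⟨hx₀, hx₁⟩
  have lower : x ≤ alpha q x := by
    have h := Finset.sum_le_sum fun p (_ : p ∈ Finset.range q) => min_sub_min_le_beta p q x
    rw [Finset.sum_range_sub (fun p : ℕ => min x ((p : ℝ) / q)),
      div_self (by positivity), min_eq_left hx₁] at h
    simpa [alpha, hx₀] using h
  have upper : alpha q x ≤ x + 1 / q := by
    obtain ⟨n, rfl⟩ := Nat.exists_eq_add_of_le' hq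
    have h := Finset.sum_le_sum fun p (_ : p ∈ Finset.range n) =>
      beta_succ_le_min_sub_min p (n + 1) x
    rw [Finset.sum_range_sub (fun p : ℕ => min x ((p : ℝ) / (n + 1 : ℕ))),
      Nat.cast_zero, zero_div, min_eq_right hx₀] at h
    rw [alpha, Finset.sum_range_succ']
    linarith [beta_le_one_div 0 (n + 1) x, min_le_left x ((n : ℝ) / (n + 1 : ℕ))]
  rw [abs_of_nonneg (by linarith)]
  linarith
end

section
/- There exists a constant C > 0 such that for all x, y ∈ [0,1] with 0 < |x − y| ≤ 1/2, it holds that |F(x) − F(y)| ≤ C / (log₂(1/|x − y|))². -/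
open scoped BigOperators

/-- Truncation of a real number to the unit interval. -/
noncomputable def unitClamp (u : ℝ) : ℝ := max 0 (min 1 u)

lemma unitClamp_mono : Monotone unitClamp := fun _ _ h =>
  max_le_max le_rfl (min_le_min le_rfl h)

lemma abs_unitClamp_sub_le (u v : ℝ) : |unitClamp u - unitClamp v| ≤ |u - v| := by
  unfold unitClamp
  refine (abs_max_sub_max_le_max _ _ _ _).trans (max_le (by simp) ?_)
  exact (abs_min_sub_min_le_max _ _ _ _).trans (max_le (by simp) le_rfl)

lemma sum_unitClamp_sub (n : ℕ) (s : ℝ) :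
    ∑ p ∈ Finset.range n, unitClamp (s - p) = min (max s 0) n := by
  induction n with
  | zero => simp
  | succ n ih =>
    rw [Finset.sum_range_succ, ih, unitClamp]
    have hn : (0 : ℝ) ≤ n := n.cast_nonneg
    push_cast
    grind

lemma unitClamp_le_unitClamp_mul {c : ℝ} (hc : 1 ≤ c) (u : ℝ) :
    unitClamp u ≤ unitClamp (c * u) := by
  rcases le_total u 0 with hu | hu
  · simp [unitClamp, hu]
  · exact unitClamp_mono (by nlinarith)

lemma unitClamp_mul_le_unitClamp_add_one {c : ℝ} (hc : 0 ≤ c) (u : ℝ) :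
    unitClamp (c * u) ≤ unitClamp (u + 1) := by
  rcases le_total u 0 with hu | hu
  · have h : c * u ≤ 0 := mul_nonpos_of_nonneg_of_nonpos hc hu
    simp [unitClamp, h]
  · simp [unitClamp, hu]

lemma beta_eq_unitClamp {q : ℕ} (hq : 0 < q) (p : ℕ) (x : ℝ) :
    beta p q x = unitClamp (2 ^ q * (q * x - p)) / q := by
  have hq' : (0 : ℝ) < q := by exact_mod_cast hq
  have h2 : (0 : ℝ) < 2 ^ q := by positivity
  unfold beta unitClamp
  rw [zpow_neg, zpow_natCast]
  split_ifs with h₁ h₂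
  · rw [le_div_iff₀ hq'] at h₁
    have h : 2 ^ q * (q * x - p) ≤ 0 := mul_nonpos_of_nonneg_of_nonpos h2.le (by linarith)
    rw [min_eq_right (by linarith), max_eq_left h, zero_div]
  · rw [not_le, div_lt_iff₀ hq'] at h₁
    rw [le_div_iff₀ hq'] at h₂
    have h : 0 ≤ 2 ^ q * (q * x - p) := mul_nonneg h2.le (by linarith)
    have h' : 2 ^ q * (q * x - p) ≤ 1 := by
      rw [← mul_inv_cancel₀ h2.ne']
      exact mul_le_mul_of_nonneg_left (by linarith) h2.le
    rw [min_eq_right h', max_eq_right h]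
    field_simp
  · rw [not_le, div_lt_iff₀ hq'] at h₂
    have h' : 1 ≤ 2 ^ q * (q * x - p) := by
      rw [← mul_inv_cancel₀ h2.ne']
      exact mul_le_mul_of_nonneg_left (by linarith) h2.le
    rw [min_eq_left h', max_eq_right zero_le_one]

lemma alpha_eq_sum_unitClamp {q : ℕ} (hq : 0 < q) (x : ℝ) :
    alpha q x = (∑ p ∈ Finset.range q, unitClamp (2 ^ q * (q * x - p))) / q := by
  simp only [alpha, beta_eq_unitClamp hq, Finset.sum_div]

lemma abs_alpha_sub_self_le {q : ℕ} (hq : 0 < q) {x : ℝ} (hx : x ∈ Set.Icc (0 : ℝ) 1) :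
    |alpha q x - x| ≤ 1 / q := by
  have hq' : (0 : ℝ) < q := by exact_mod_cast hq
  have h0 : 0 ≤ (q : ℝ) * x := mul_nonneg hq'.le hx.1
  have hle : (q : ℝ) * x ≤ q := mul_le_of_le_one_right hq'.le hx.2
  have hlow : (q : ℝ) * x ≤ ∑ p ∈ Finset.range q, unitClamp (2 ^ q * (q * x - p)) := by
    calc (q : ℝ) * x = ∑ p ∈ Finset.range q, unitClamp (q * x - p) := by
          rw [sum_unitClamp_sub, max_eq_left h0, min_eq_left hle]
      _ ≤ _ := Finset.sum_le_sum fun p _ =>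
          unitClamp_le_unitClamp_mul (one_le_pow₀ one_le_two) _
  have hup : ∑ p ∈ Finset.range q, unitClamp (2 ^ q * (q * x - p)) ≤ q * x + 1 := by
    calc _ ≤ ∑ p ∈ Finset.range q, unitClamp (q * x + 1 - p) :=
          Finset.sum_le_sum fun p _ => by
            rw [add_sub_right_comm]
            exact unitClamp_mul_le_unitClamp_add_one (by positivity) _
      _ ≤ q * x + 1 := by
          rw [sum_unitClamp_sub, max_eq_left (by linarith)]
          exact min_le_left _ _
  rw [alpha_eq_sum_unitClamp hq, abs_le]
  constructor
  · have := (le_div_iff₀' hq').2 hlow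
    have : 0 ≤ 1 / (q : ℝ) := by positivity
    linarith
  · rw [sub_le_iff_le_add, div_le_iff₀ hq']
    have : (1 / (q : ℝ) + x) * q = q * x + 1 := by field_simp; ring
    linarith

lemma abs_alpha_sub_le_lipschitz {q : ℕ} (hq : 0 < q) (x y : ℝ) :
    |alpha q x - alpha q y| ≤ q * 2 ^ q * |x - y| := by
  have hq' : (0 : ℝ) < q := by exact_mod_cast hq
  rw [alpha, alpha, ← Finset.sum_sub_distrib]
  refine (Finset.abs_sum_le_sum_abs _ _).trans ?_
  refine (Finset.sum_le_card_nsmul _ _ (2 ^ q * |x - y|) fun p _ => ?_).trans_eq ?_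
  · rw [beta_eq_unitClamp hq, beta_eq_unitClamp hq, ← sub_div, abs_div, abs_of_pos hq',
      div_le_iff₀ hq']
    refine (abs_unitClamp_sub_le _ _).trans_eq ?_
    rw [← mul_sub, sub_sub_sub_cancel_right, ← mul_sub, abs_mul, abs_mul, abs_of_pos hq',
      abs_of_pos (by positivity : (0 : ℝ) < 2 ^ q)]
    ring
  · simp [mul_assoc]

lemma abs_alpha_sub_le {q : ℕ} (hq : 0 < q) {x y : ℝ} (hx : x ∈ Set.Icc (0 : ℝ) 1)
    (hy : y ∈ Set.Icc (0 : ℝ) 1) : |alpha q x - alpha q y| ≤ |x - y| + 2 / q := by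
  have h1 := abs_alpha_sub_self_le hq hx
  have h2 := abs_alpha_sub_self_le hq hy
  have h3 : (2 : ℝ) / q = 1 / q + 1 / q := by ring
  have h4 := le_abs_self (x - y)
  have h5 := neg_abs_le (x - y)
  rw [abs_le] at *
  constructor <;> linarith

lemma summable_F_terms {x : ℝ} (hx : x ∈ Set.Icc (0 : ℝ) 1) :
    Summable fun n : ℕ => (1 / ((n : ℝ) + 1) ^ 2) * alpha (n + 1) x := by
  have hs : Summable fun n : ℕ => (1 / ((n : ℝ) + 1) ^ 2) * 2 := by
    have := (summable_nat_add_iff 1).2 (Real.summable_one_div_nat_pow.2 one_lt_two)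
    simpa using this.mul_right 2
  refine Summable.of_norm_bounded hs fun n => ?_
  rw [Real.norm_eq_abs, abs_mul, abs_of_pos (by positivity)]
  gcongr
  have h1 := abs_le.1 (abs_alpha_sub_self_le n.succ_pos hx)
  have h2 : (1 : ℝ) / (n.succ : ℕ) ≤ 1 := by
    rw [div_le_one (by positivity)]
    exact_mod_cast n.succ_pos
  obtain ⟨h3, h4⟩ := hx
  exact abs_le.2 ⟨by linarith [h1.1], by linarith [h1.2]⟩

lemma one_div_sq_le_telescope {a : ℝ} (ha : 1 ≤ a) :
    1 / a ^ 2 ≤ 2 / a - 2 / (a + 1) := by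
  have h : 2 / a - 2 / (a + 1) = 2 / (a * (a + 1)) := by field_simp; ring
  rw [h, div_le_div_iff₀ (by positivity) (by positivity)]
  nlinarith

lemma one_div_cube_le_telescope {a : ℝ} (ha : 1 ≤ a) :
    1 / a ^ 3 ≤ 2 / a ^ 2 - 2 / (a + 1) ^ 2 := by
  have h : 2 / a ^ 2 - 2 / (a + 1) ^ 2 = (4 * a + 2) / (a ^ 2 * (a + 1) ^ 2) := by
    field_simp; ring
  rw [h, div_le_div_iff₀ (by positivity) (by positivity)]
  have : 0 ≤ a ^ 2 * (3 * a ^ 2 - 1) := by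
    have : 0 ≤ 3 * a ^ 2 - 1 := by nlinarith
    positivity
  nlinarith

lemma abs_F_sub_le {x y : ℝ} (hx : x ∈ Set.Icc (0 : ℝ) 1) (hy : y ∈ Set.Icc (0 : ℝ) 1)
    (N : ℕ) :
    |F x - F y| ≤ 2 * 2 ^ N * |x - y| + (2 * |x - y| / (N + 1) + 4 / ((N : ℝ) + 1) ^ 2) := by
  set h := |x - y|
  have h_nonneg : 0 ≤ h := abs_nonneg _
  have hsx := summable_F_terms hx
  have hsy := summable_F_terms hy
  set f : ℕ → ℝ := fun n => (1 / ((n : ℝ) + 1) ^ 2) * |alpha (n + 1) x - alpha (n + 1) y|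
  have hf_nonneg (n : ℕ) : 0 ≤ f n := by positivity
  have hf_eq (n : ℕ) : ‖(1 / ((n : ℝ) + 1) ^ 2) * alpha (n + 1) x -
      (1 / ((n : ℝ) + 1) ^ 2) * alpha (n + 1) y‖ = f n := by
    rw [← mul_sub, Real.norm_eq_abs, abs_mul, abs_of_pos (by positivity)]
  have hf_summable : Summable f := by
    simpa only [hf_eq] using (hsx.sub hsy).norm
  have hF : |F x - F y| ≤ ∑' n, f n := by
    rw [F, F, ← hsx.tsum_sub hsy, ← Real.norm_eq_abs]
    simpa only [hf_eq] using norm_tsum_le_tsum_norm (hsx.sub hsy).norm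
  refine hF.trans (Real.tsum_le_of_sum_range_le hf_nonneg fun M => ?_)
  have hhead : ∑ n ∈ Finset.range N, f n ≤ 2 * 2 ^ N * h := by
    have hle : ∀ n ∈ Finset.range N, f n ≤ 2 * h * 2 ^ n := fun n _ => by
      have h1 := abs_alpha_sub_le_lipschitz n.succ_pos x y
      have hn : (1 : ℝ) ≤ (n : ℝ) + 1 := by linarith [n.cast_nonneg (α := ℝ)]
      calc f n ≤ 1 / ((n : ℝ) + 1) ^ 2 * (((n : ℝ) + 1) * 2 ^ (n + 1) * h) := by
            refine mul_le_mul_of_nonneg_left ?_ (by positivity)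
            simpa using h1
        _ = (2 * h * 2 ^ n) / ((n : ℝ) + 1) := by field_simp; ring
        _ ≤ 2 * h * 2 ^ n := div_le_self (by positivity) hn
    refine (Finset.sum_le_sum hle).trans ?_
    rw [← Finset.mul_sum, geom_sum_eq (by norm_num)]
    have : 0 ≤ h * 2 ^ N := by positivity
    norm_num
    nlinarith
  set Φ : ℕ → ℝ := fun i => 2 * h / ((N + i : ℕ) + 1) + 4 / (((N + i : ℕ) : ℝ) + 1) ^ 2
  have htail : ∑ i ∈ Finset.range M, f (N + i) ≤ Φ 0 - Φ M := by
    rw [← Finset.sum_range_sub']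
    refine Finset.sum_le_sum fun i _ => ?_
    have h1 := abs_alpha_sub_le (N + i).succ_pos hx hy
    have ha : (1 : ℝ) ≤ ((N + i : ℕ) : ℝ) + 1 := by
      linarith [(N + i).cast_nonneg (α := ℝ)]
    have hΦ : Φ (i + 1) = 2 * h / (((N + i : ℕ) : ℝ) + 1 + 1) +
        4 / (((N + i : ℕ) : ℝ) + 1 + 1) ^ 2 := by
      simp only [Φ, ← add_assoc, Nat.cast_add, Nat.cast_one]
    rw [hΦ]
    simp only [f, Φ]
    rw [Nat.cast_succ] at h1
    set a : ℝ := ((N + i : ℕ) : ℝ) + 1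
    have h2 := mul_le_mul_of_nonneg_left (one_div_sq_le_telescope ha) h_nonneg
    have h3 := one_div_cube_le_telescope ha
    calc 1 / a ^ 2 * |alpha (N + i + 1) x - alpha (N + i + 1) y|
        ≤ 1 / a ^ 2 * (h + 2 / a) := mul_le_mul_of_nonneg_left h1 (by positivity)
      _ = h * (1 / a ^ 2) + 2 * (1 / a ^ 3) := by field_simp
      _ ≤ h * (2 / a - 2 / (a + 1)) + 2 * (2 / a ^ 2 - 2 / (a + 1) ^ 2) := by linarith
      _ = 2 * h / a + 4 / a ^ 2 - (2 * h / (a + 1) + 4 / (a + 1) ^ 2) := by ring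
  have hΦM : 0 ≤ Φ M := by positivity
  calc ∑ n ∈ Finset.range M, f n ≤ ∑ n ∈ Finset.range (N + M), f n :=
        Finset.sum_le_sum_of_subset_of_nonneg
          (Finset.range_mono (Nat.le_add_left M N)) fun n _ _ => hf_nonneg n
    _ = ∑ n ∈ Finset.range N, f n + ∑ i ∈ Finset.range M, f (N + i) :=
        Finset.sum_range_add _ _ _
    _ ≤ 2 * 2 ^ N * h + Φ 0 := by linarith
    _ = _ := by simp [Φ]

theorem F_log_modulus :
    ∃ C : ℝ, 0 < C ∧ ∀ x ∈ Set.Icc (0:ℝ) 1, ∀ y ∈ Set.Icc (0:ℝ) 1,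
      0 < |x - y| → |x - y| ≤ 1 / 2 →
      |F x - F y| ≤ C / (Real.logb 2 (1 / |x - y|)) ^ 2 := by
  refine ⟨88, by norm_num, fun x hx y hy hpos hle => ?_⟩
  set h := |x - y|
  set L := Real.logb 2 (1 / h) with hL_def
  have hL : 1 ≤ L := by
    rw [hL_def, Real.le_logb_iff_rpow_le one_lt_two (by positivity), Real.rpow_one,
      le_div_iff₀ hpos]
    linarith
  set r : ℝ := 2 ^ (L / 2) with hr_def
  have hr_pos : 0 < r := by positivity
  have hr_sq : r * r * h = 1 := by
    rw [hr_def, ← Real.rpow_add two_pos, add_halves, hL_def,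
      Real.rpow_logb two_pos (by norm_num) (by positivity), one_div_mul_cancel hpos.ne']
  have hr_lower : 1 + L / 4 + L ^ 2 / 32 ≤ r := by
    rw [hr_def, Real.rpow_def_of_pos two_pos]
    refine le_trans ?_ (Real.exp_le_exp.2 (?_ : L / 4 ≤ _))
    · have := Real.quadratic_le_exp_of_nonneg (x := L / 4) (by positivity)
      linarith
    · nlinarith [Real.log_two_gt_d9]
  have hrh : r * h ≤ 32 / L ^ 2 := by
    rw [le_div_iff₀ (by positivity)]
    have : r * h * (L ^ 2 / 32) ≤ r * h * r :=
      mul_le_mul_of_nonneg_left (by linarith [sq_nonneg L]) (by positivity)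
    linarith
  have hhL : h ≤ 2 / L := by
    rw [le_div_iff₀ (by positivity)]
    have : L / 2 ≤ r * r := by nlinarith [sq_nonneg L]
    nlinarith
  set N := ⌊L / 2⌋₊
  have hN_pow : (2 : ℝ) ^ N ≤ r := by
    rw [← Real.rpow_natCast]
    exact Real.rpow_le_rpow_of_exponent_le one_le_two (Nat.floor_le (by positivity))
  have hN : L / 2 ≤ (N : ℝ) + 1 := (Nat.lt_floor_add_one _).le
  calc |F x - F y| ≤ 2 * 2 ^ N * h + (2 * h / (N + 1) + 4 / ((N : ℝ) + 1) ^ 2) :=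
        abs_F_sub_le hx hy N
    _ ≤ 2 * r * h + (2 * (2 / L) / (L / 2) + 4 / (L / 2) ^ 2) := by gcongr
    _ = 2 * (r * h) + 24 / L ^ 2 := by field_simp; ring
    _ ≤ 2 * (32 / L ^ 2) + 24 / L ^ 2 := by gcongr
    _ = 88 / L ^ 2 := by ring
end

section
/- Jump lemma: for all natural numbers a, b with b ≥ 1 and 0 ≤ a ≤ b − 1, it holds that F(a/b + 2^{−b}/b) − F(a/b) ≥ 1/b³. -/
open scoped BigOperators

theorem beta_eq_max_min (p : ℕ) {q : ℕ} (hq : 1 ≤ q) (x : ℝ) :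
    beta p q x = max 0 (min (1 / (q : ℝ)) ((2 : ℝ) ^ q * (x - (p : ℝ) / q))) := by
  have hq' : (0 : ℝ) < q := by exact_mod_cast hq
  have h2 : (0 : ℝ) < 2 ^ q := by positivity
  have hslope : (2 : ℝ) ^ q * (2 : ℝ) ^ (-(q : ℤ)) = 1 := by
    rw [zpow_neg, zpow_natCast]
    exact mul_inv_cancel₀ h2.ne'
  have hend : (2 : ℝ) ^ q * (((p : ℝ) + (2 : ℝ) ^ (-(q : ℤ))) / q - (p : ℝ) / q) = 1 / q := by
    rw [← sub_div, add_sub_cancel_left, ← mul_div_assoc, hslope]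
  have hinv : (0 : ℝ) < 1 / q := by positivity
  unfold beta
  split_ifs with h₁ h₂
  · rw [max_eq_left]
    exact (min_le_right _ _).trans (mul_nonpos_of_nonneg_of_nonpos h2.le (by linarith))
  · have hle : (2 : ℝ) ^ q * (x - (p : ℝ) / q) ≤ 1 / q := by
      rw [← hend]
      gcongr
    rw [min_eq_right hle, max_eq_right]
    exact mul_nonneg h2.le (by linarith)
  · have hle : 1 / (q : ℝ) ≤ (2 : ℝ) ^ q * (x - (p : ℝ) / q) := by
      rw [← hend]
      gcongr
      exact (not_le.mp h₂).le
    rw [min_eq_left hle, max_eq_right hinv.le]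

theorem beta_mono (p : ℕ) {q : ℕ} (hq : 1 ≤ q) : Monotone (beta p q) := by
  intro x y hxy
  rw [beta_eq_max_min p hq, beta_eq_max_min p hq]
  gcongr

theorem beta_nonneg (p : ℕ) {q : ℕ} (hq : 1 ≤ q) (x : ℝ) : 0 ≤ beta p q x := by
  rw [beta_eq_max_min p hq]
  exact le_max_left _ _

theorem beta_le (p : ℕ) {q : ℕ} (hq : 1 ≤ q) (x : ℝ) : beta p q x ≤ 1 / q := by
  rw [beta_eq_max_min p hq]
  exact max_le (by positivity) (min_le_left _ _)

theorem beta_left (p q : ℕ) : beta p q ((p : ℝ) / q) = 0 := by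
  simp [beta]

theorem beta_right (p : ℕ) {q : ℕ} (hq : 1 ≤ q) :
    beta p q ((p : ℝ) / q + (2 : ℝ) ^ (-(q : ℤ)) / q) = 1 / q := by
  rw [beta_eq_max_min p hq, add_sub_cancel_left, ← mul_div_assoc, zpow_neg, zpow_natCast,
    mul_inv_cancel₀ (by positivity), min_self, max_eq_right (by positivity)]

theorem alpha_mono {q : ℕ} (hq : 1 ≤ q) : Monotone (alpha q) :=
  fun _ _ hxy => Finset.sum_le_sum fun p _ => beta_mono p hq hxy

theorem alpha_nonneg {q : ℕ} (hq : 1 ≤ q) (x : ℝ) : 0 ≤ alpha q x :=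
  Finset.sum_nonneg fun p _ => beta_nonneg p hq x

theorem alpha_le_one {q : ℕ} (hq : 1 ≤ q) (x : ℝ) : alpha q x ≤ 1 := by
  have hq' : (q : ℝ) ≠ 0 := by exact_mod_cast (by lia : q ≠ 0)
  calc alpha q x ≤ ∑ _p ∈ Finset.range q, 1 / (q : ℝ) :=
        Finset.sum_le_sum fun p _ => beta_le p hq x
    _ = 1 := by simp [hq']

theorem summable_F (x : ℝ) :
    Summable fun q : ℕ => (1 / ((q : ℝ) + 1) ^ 2) * alpha (q + 1) x := by
  have hsq : Summable fun q : ℕ => 1 / ((q : ℝ) + 1) ^ 2 := by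
    simpa using (summable_nat_add_iff 1).mpr (Real.summable_one_div_nat_pow.mpr one_lt_two)
  refine Summable.of_nonneg_of_le (fun q => ?_) (fun q => ?_) hsq
  · exact mul_nonneg (by positivity) (alpha_nonneg (by lia) x)
  · exact mul_le_of_le_one_right (by positivity) (alpha_le_one (by lia) x)

theorem alpha_jump {a b : ℕ} (hab : a < b) :
    1 / (b : ℝ) ≤
      alpha b ((a : ℝ) / b + (2 : ℝ) ^ (-(b : ℤ)) / b) - alpha b ((a : ℝ) / b) := by
  have hb : 1 ≤ b := by lia
  have hle : (a : ℝ) / b ≤ (a : ℝ) / b + (2 : ℝ) ^ (-(b : ℤ)) / b :=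
    le_add_of_nonneg_right (by positivity)
  unfold alpha
  rw [← Finset.sum_sub_distrib]
  refine le_trans (le_of_eq ?_) (Finset.single_le_sum
    (fun p _ => sub_nonneg.mpr (beta_mono p hb hle)) (Finset.mem_range.mpr hab))
  rw [beta_right a hb, beta_left, sub_zero]

theorem F_jump (a b : ℕ) (hb : 1 ≤ b) (ha : a ≤ b - 1) :
    F ((a : ℝ) / b + (2:ℝ) ^ (-(b:ℤ)) / b) - F ((a : ℝ) / b) ≥ 1 / (b : ℝ) ^ 3 := by
  have hle : (a : ℝ) / b ≤ (a : ℝ) / b + (2 : ℝ) ^ (-(b : ℤ)) / b :=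
    le_add_of_nonneg_right (by positivity)
  have hjump := alpha_jump (show a < b by lia)
  generalize (a : ℝ) / b + (2 : ℝ) ^ (-(b : ℤ)) / b = y at *
  generalize (a : ℝ) / b = x at *
  obtain ⟨n, rfl⟩ : ∃ n, b = n + 1 := ⟨b - 1, by lia⟩
  unfold F
  rw [← (summable_F y).tsum_sub (summable_F x)]
  refine le_trans ?_ (((summable_F y).sub (summable_F x)).le_tsum n fun q _ =>
    sub_nonneg.mpr (mul_le_mul_of_nonneg_left (alpha_mono (by lia) hle) (by positivity)))
  push_cast at hjump ⊢
  calc 1 / ((n : ℝ) + 1) ^ 3 = 1 / ((n : ℝ) + 1) ^ 2 * (1 / ((n : ℝ) + 1)) := by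
        field_simp
    _ ≤ 1 / ((n : ℝ) + 1) ^ 2 * (alpha (n + 1) y - alpha (n + 1) x) := by gcongr
    _ = _ := mul_sub _ _ _
end
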